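/- arXiv:1411.3359 — 2 statements merged into one kernel-verified Lean document; each statement's English description precedes it below -/
import Mathlib

section
/- Define η_j := (Σ_{σ∈Λ_j} m(σ) log t_σ)/(Σ_{σ∈Λ_j} m(σ) log s_σ) for j ≥ 1 and d₀ := (Σ_{i=1}^N t_i log t_i)/(Σ_{i=1}^N t_i log s_i). Then there exist a constant C₄ > 0 and j₀ ≥ 1 such that |η_j − d₀| ≤ C₄/j for all j ≥ j₀. -/
/-- `p_σ = ∏_h p_{σ_h}` for a word `σ` over the alphabet `{1,…,N}`
(letter `i ∈ {1,…,N}` carries weight `p i`, where `p` is indexed by `{0,1,…,N}`). -/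
def pword {N : ℕ} (p : Fin (N + 1) → ℝ) (σ : List (Fin N)) : ℝ :=
  (σ.map fun i => p i.succ).prod

/-- `a_σ = ∏_h a_{σ_h}` for a word `σ` over the alphabet `{1,…,N}`. -/
def aword {N : ℕ} (a : Fin N → ℝ) (σ : List (Fin N)) : ℝ := (σ.map a).prod

/-- `μ⁽¹⁾(σ) = Σ_{h=0}^{|σ|-1} p₀ p_{σ|_h} t_{σ^{(l)}_{-h}}`. -/
def mu1 {N : ℕ} (p : Fin (N + 1) → ℝ) (t : Fin N → ℝ) (σ : List (Fin N)) : ℝ :=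
  ∑ h ∈ Finset.range σ.length, p 0 * pword p (σ.take h) * aword t (σ.drop h)

/-- `m(σ) = μ⁽¹⁾(σ) + p_σ`. -/
def mWeight {N : ℕ} (p : Fin (N + 1) → ℝ) (t : Fin N → ℝ) (σ : List (Fin N)) : ℝ :=
  mu1 p t σ + pword p σ

/-- The finite maximal antichain `Λ_j = {σ ∈ Ω^* : t_{σ⁻} ≥ t̲^j > t_σ}`,
where `t̲ = min_i t_i`. -/
def Lam {N : ℕ} (t : Fin N → ℝ) (j : ℕ) : Set (List (Fin N)) :=
  {σ | σ ≠ [] ∧ (⨅ i, t i) ^ j ≤ aword t σ.dropLast ∧ aword t σ < (⨅ i, t i) ^ j}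

lemma pword_snoc {N : ℕ} (p : Fin (N + 1) → ℝ) (σ : List (Fin N)) (i : Fin N) :
    pword p (σ ++ [i]) = pword p σ * p i.succ := by
  simp [pword]

lemma aword_snoc {N : ℕ} (a : Fin N → ℝ) (σ : List (Fin N)) (i : Fin N) :
    aword a (σ ++ [i]) = aword a σ * a i := by
  simp [aword]

lemma mu1_snoc {N : ℕ} (p : Fin (N + 1) → ℝ) (t : Fin N → ℝ) (σ : List (Fin N)) (i : Fin N) :
    mu1 p t (σ ++ [i]) = mu1 p t σ * t i + p 0 * pword p σ * t i := by
  unfold mu1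
  rw [List.length_append, List.length_singleton, Finset.sum_range_succ, Finset.sum_mul]
  congr 1
  · refine Finset.sum_congr rfl fun h hh => ?_
    have hh := Finset.mem_range.1 hh
    rw [List.take_append_of_le_length hh.le, List.drop_append_of_le_length hh.le, aword_snoc]
    ring
  · simp [aword]

lemma mW_snoc {N : ℕ} (p : Fin (N + 1) → ℝ) (t : Fin N → ℝ) (σ : List (Fin N)) (i : Fin N) :
    mWeight p t (σ ++ [i]) =
      mWeight p t σ * t i + pword p σ * (p i.succ - (1 - p 0) * t i) := by
  unfold mWeight
  rw [mu1_snoc, pword_snoc]; ring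

lemma pword_pos {N : ℕ} (p : Fin (N + 1) → ℝ) (hp : ∀ i, 0 < p i) (σ : List (Fin N)) :
    0 < pword p σ := by
  unfold pword
  apply List.prod_pos
  simp only [List.mem_map]
  rintro _ ⟨i, _, rfl⟩
  exact hp _

lemma aword_pos {N : ℕ} (a : Fin N → ℝ) (ha : ∀ i, 0 < a i) (σ : List (Fin N)) :
    0 < aword a σ := by
  unfold aword
  apply List.prod_pos
  simp only [List.mem_map]
  rintro _ ⟨i, _, rfl⟩
  exact ha _

lemma mW_pos {N : ℕ} (p : Fin (N + 1) → ℝ) (hp : ∀ i, 0 < p i)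
    (t : Fin N → ℝ) (ht : ∀ i, 0 < t i) (σ : List (Fin N)) : 0 < mWeight p t σ := by
  unfold mWeight mu1
  have h1 := pword_pos p hp σ
  have : 0 ≤ ∑ h ∈ Finset.range σ.length, p 0 * pword p (σ.take h) * aword t (σ.drop h) :=
    Finset.sum_nonneg fun h _ =>
      (mul_pos (mul_pos (hp 0) (pword_pos p hp _)) (aword_pos t ht _)).le
  linarith

/-- children of a finite set of words -/
def kids {N : ℕ} (I : Finset (List (Fin N))) : Finset (List (Fin N)) :=
  (I ×ˢ (Finset.univ : Finset (Fin N))).image fun x => x.1 ++ [x.2]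

lemma mem_kids {N : ℕ} (I : Finset (List (Fin N))) (σ : List (Fin N)) :
    σ ∈ kids I ↔ σ ≠ [] ∧ σ.dropLast ∈ I := by
  unfold kids
  simp only [Finset.mem_image, Finset.mem_product, Finset.mem_univ, and_true, Prod.exists]
  constructor
  · rintro ⟨a, b, h, rfl⟩
    simpa using h
  · rintro ⟨h, h2⟩
    exact ⟨_, _, h2, List.dropLast_append_getLast h⟩

lemma sum_kids {N : ℕ} (I : Finset (List (Fin N))) (F : List (Fin N) → ℝ) :
    ∑ σ ∈ kids I, F σ = ∑ ρ ∈ I, ∑ i, F (ρ ++ [i]) := by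
  unfold kids
  rw [Finset.sum_image, Finset.sum_product]
  rintro ⟨a, b⟩ _ ⟨c, d⟩ _ h
  have := List.append_inj' h rfl
  simp only [List.cons.injEq, and_true] at this
  exact Prod.ext this.1 this.2

/-- words of length `n` -/
def wds (N : ℕ) : ℕ → Finset (List (Fin N))
  | 0 => {[]}
  | n + 1 => kids (wds N n)

lemma mem_wds {N : ℕ} (n : ℕ) (σ : List (Fin N)) : σ ∈ wds N n ↔ σ.length = n := by
  induction n generalizing σ with
  | zero => simp [wds]
  | succ n ih =>
    rw [wds, mem_kids, ih, List.length_dropLast]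
    constructor
    · rintro ⟨h, h2⟩
      have := List.length_pos_iff.2 h
      omega
    · intro h
      refine ⟨?_, by omega⟩
      rintro rfl
      simp at h

lemma sum_biU {N : ℕ} (n : ℕ) (F : List (Fin N) → ℝ) :
    ∑ σ ∈ (Finset.range n).biUnion (wds N), F σ = ∑ k ∈ Finset.range n, ∑ σ ∈ wds N k, F σ := by
  apply Finset.sum_biUnion
  intro a _ b _ hab
  rw [Function.onFun, Finset.disjoint_left]
  intro σ h1 h2
  rw [mem_wds] at h1 h2
  exact hab (h1.symm.trans h2)

lemma mem_biU {N : ℕ} (n : ℕ) (σ : List (Fin N)) :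
    σ ∈ (Finset.range n).biUnion (wds N) ↔ σ.length < n := by
  simp [mem_wds]

lemma psum' {N : ℕ} (p : Fin (N + 1) → ℝ) (hpsum : ∑ i, p i = 1) :
    ∑ i : Fin N, p i.succ = 1 - p 0 := by
  rw [Fin.sum_univ_succ] at hpsum; linarith

lemma sum_pword {N : ℕ} (p : Fin (N + 1) → ℝ) (hpsum : ∑ i, p i = 1) (n : ℕ) :
    ∑ σ ∈ wds N n, pword p σ = (1 - p 0) ^ n := by
  induction n with
  | zero => simp [wds, pword]
  | succ n ih =>
    rw [wds, sum_kids, pow_succ, ← ih, Finset.sum_mul]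
    refine Finset.sum_congr rfl fun ρ _ => ?_
    simp_rw [pword_snoc]
    rw [← Finset.mul_sum, psum' p hpsum]

lemma sum_mW_snoc {N : ℕ} (p : Fin (N + 1) → ℝ) (hpsum : ∑ i, p i = 1)
    (t : Fin N → ℝ) (htsum : ∑ i, t i = 1) (ρ : List (Fin N)) :
    ∑ i, mWeight p t (ρ ++ [i]) = mWeight p t ρ := by
  simp_rw [mW_snoc]
  rw [Finset.sum_add_distrib, ← Finset.mul_sum, ← Finset.mul_sum, Finset.sum_sub_distrib,
    ← Finset.mul_sum, htsum, psum' p hpsum]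
  ring

lemma sum_mW {N : ℕ} (p : Fin (N + 1) → ℝ) (hpsum : ∑ i, p i = 1)
    (t : Fin N → ℝ) (htsum : ∑ i, t i = 1) (n : ℕ) :
    ∑ σ ∈ wds N n, mWeight p t σ = 1 := by
  induction n with
  | zero => simp [wds, mWeight, mu1, pword]
  | succ n ih =>
    rw [wds, sum_kids, ← ih]
    exact Finset.sum_congr rfl fun ρ _ => sum_mW_snoc p hpsum t htsum ρ

lemma aword_le {N : ℕ} (t : Fin N → ℝ) (ht : ∀ i, 0 < t i) (r : ℝ) (hr : ∀ i, t i ≤ r)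
    (σ : List (Fin N)) : aword t σ ≤ r ^ σ.length := by
  induction σ using List.reverseRecOn with
  | nil => simp [aword]
  | append_singleton l a ih =>
    rw [aword_snoc, List.length_append, List.length_singleton, pow_succ]
    exact mul_le_mul ih (hr a) (ht a).le ((aword_pos t ht l).le.trans ih)

lemma le_aword {N : ℕ} (t : Fin N → ℝ) (ht : ∀ i, 0 < t i) (r : ℝ) (hr0 : 0 < r)
    (hr : ∀ i, r ≤ t i) (σ : List (Fin N)) : r ^ σ.length ≤ aword t σ := by
  induction σ using List.reverseRecOn with
  | nil => simp [aword]
  | append_singleton l a ih =>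
    rw [aword_snoc, List.length_append, List.length_singleton, pow_succ]
    exact mul_le_mul ih (hr a) hr0.le (aword_pos t ht l).le

/-- Wald-type identity -/
lemma wald {N : ℕ} (p : Fin (N + 1) → ℝ) (hpsum : ∑ i, p i = 1)
    (t : Fin N → ℝ) (ht : ∀ i, 0 < t i) (ht1 : ∀ i, t i < 1) (htsum : ∑ i, t i = 1)
    (a : Fin N → ℝ) (ha : ∀ i, 0 < a i) (j : ℕ) (I : Finset (List (Fin N)))
    (hI : ∀ σ, σ ∈ I ↔ (⨅ i, t i) ^ j ≤ aword t σ) (h0 : [] ∈ I) :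
    ∑ᶠ σ ∈ Lam t j, mWeight p t σ * Real.log (aword a σ) =
      (∑ ρ ∈ I, mWeight p t ρ) * (∑ i, t i * Real.log (a i)) +
      (∑ ρ ∈ I, pword p ρ) * (∑ i, (p i.succ - (1 - p 0) * t i) * Real.log (a i)) := by
  set F : List (Fin N) → ℝ := fun σ => mWeight p t σ * Real.log (aword a σ) with hF
  have hF0 : F [] = 0 := by simp [hF, aword]
  have hsub : I.erase [] ⊆ kids I := by
    intro σ hσ
    obtain ⟨h1, h2⟩ := Finset.mem_erase.1 hσ
    rw [mem_kids]
    refine ⟨h1, ?_⟩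
    rw [hI] at h2 ⊢
    refine h2.trans ?_
    conv_lhs => rw [← List.dropLast_append_getLast h1]
    rw [aword_snoc]
    exact mul_le_of_le_one_right (aword_pos t ht _).le (ht1 _).le
  have hL : Lam t j = ↑(kids I \ I.erase []) := by
    ext σ
    simp only [Lam, Set.mem_setOf_eq, Finset.coe_sdiff, Set.mem_sdiff, Finset.mem_coe, mem_kids,
      Finset.mem_erase, hI, not_and, not_le]
    tauto
  rw [hL, finsum_mem_coe_finset]
  have e1 := Finset.sum_sdiff (f := F) hsub
  have e2 := Finset.sum_erase I hF0
  rw [sum_kids, e2] at e1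
  have e3 : ∑ σ ∈ kids I \ I.erase [], F σ = ∑ ρ ∈ I, (∑ i, F (ρ ++ [i]) - F ρ) := by
    rw [Finset.sum_sub_distrib]; linarith
  rw [e3, Finset.sum_mul, Finset.sum_mul, ← Finset.sum_add_distrib]
  refine Finset.sum_congr rfl fun ρ _ => ?_
  have e4 : ∑ i, F (ρ ++ [i]) = mWeight p t ρ * Real.log (aword a ρ) +
      ∑ i, mWeight p t (ρ ++ [i]) * Real.log (a i) := by
    rw [← sum_mW_snoc p hpsum t htsum ρ, Finset.sum_mul, ← Finset.sum_add_distrib]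
    refine Finset.sum_congr rfl fun i _ => ?_
    simp only [hF]
    rw [aword_snoc, Real.log_mul (aword_pos a ha _).ne' (ha i).ne']
    ring
  rw [e4]
  simp only [hF]
  rw [add_sub_cancel_left, Finset.mul_sum, Finset.mul_sum, ← Finset.sum_add_distrib]
  refine Finset.sum_congr rfl fun i _ => ?_
  rw [mW_snoc]; ring

theorem stmt16 (N : ℕ) (hN : 2 ≤ N)
    (p : Fin (N + 1) → ℝ) (hp : ∀ i, 0 < p i) (hpsum : ∑ i, p i = 1)
    (t : Fin N → ℝ) (ht : ∀ i, 0 < t i) (htsum : ∑ i, t i = 1)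
    (s : Fin N → ℝ) (hs : ∀ i, s i ∈ Set.Ioo (0 : ℝ) 1)
    (η : ℕ → ℝ)
    (hη : ∀ j : ℕ, 1 ≤ j → η j =
      (∑ᶠ σ ∈ Lam t j, mWeight p t σ * Real.log (aword t σ)) /
      (∑ᶠ σ ∈ Lam t j, mWeight p t σ * Real.log (aword s σ)))
    (d₀ : ℝ) (hd₀ : d₀ = (∑ i, t i * Real.log (t i)) / (∑ i, t i * Real.log (s i))) :
    ∃ C₄ : ℝ, 0 < C₄ ∧ ∃ j₀ : ℕ, 1 ≤ j₀ ∧ ∀ j : ℕ, j₀ ≤ j →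
      |η j - d₀| ≤ C₄ / j := by
  have hne : Nonempty (Fin N) := ⟨⟨0, by omega⟩⟩
  have ht1 : ∀ i, t i < 1 := by
    intro i
    have : Nontrivial (Fin N) := Fin.nontrivial_iff_two_le.2 hN
    obtain ⟨k, hk⟩ := exists_ne i
    rw [← htsum]
    exact Finset.single_lt_sum hk (Finset.mem_univ i) (Finset.mem_univ k) (ht k)
      (fun l _ _ => (ht l).le)
  have hmin0 : 0 < ⨅ i, t i := by
    obtain ⟨i, hi⟩ := exists_eq_ciInf_of_finite (f := t)
    rw [← hi]; exact ht i
  have hminle : ∀ i, ⨅ i, t i ≤ t i := fun i => ciInf_le (Set.finite_range t).bddBelow i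
  have hmin1 : ⨅ i, t i ≤ 1 := (hminle hne.some).trans (ht1 _).le
  obtain ⟨r, hr0, hr1, hr⟩ : ∃ r : ℝ, 0 ≤ r ∧ r < 1 ∧ ∀ i, t i ≤ r := by
    obtain ⟨i, hi⟩ := Finite.exists_max t
    exact ⟨t i, (ht i).le, ht1 i, hi⟩
  have hp01 : p 0 < 1 := by
    have h1 := psum' p hpsum
    have : 0 < ∑ i : Fin N, p i.succ :=
      Finset.sum_pos (fun i _ => hp _) Finset.univ_nonempty
    linarith
  have key : ∀ j : ℕ, ∃ I : Finset (List (Fin N)), (∀ σ, σ ∈ I ↔ (⨅ i, t i) ^ j ≤ aword t σ) ∧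
      [] ∈ I ∧ (j : ℝ) ≤ ∑ ρ ∈ I, mWeight p t ρ ∧ 0 ≤ ∑ ρ ∈ I, pword p ρ ∧
      ∑ ρ ∈ I, pword p ρ ≤ 1 / p 0 := by
    intro j
    obtain ⟨L, hL⟩ := exists_pow_lt_of_lt_one (pow_pos hmin0 j) hr1
    classical
    set U := (Finset.range L).biUnion (wds N) with hU
    have hmem : ∀ σ, σ ∈ U.filter (fun σ => (⨅ i, t i) ^ j ≤ aword t σ) ↔
        (⨅ i, t i) ^ j ≤ aword t σ := by
      intro σ
      rw [Finset.mem_filter, hU, mem_biU]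
      refine ⟨fun h => h.2, fun h => ⟨?_, h⟩⟩
      by_contra hc
      have h1 := aword_le t ht r hr σ
      have h2 := pow_le_pow_of_le_one hr0 hr1.le (not_lt.1 hc)
      linarith
    refine ⟨_, hmem, ?_, ?_, ?_, ?_⟩
    · rw [hmem]; simpa [aword] using pow_le_one₀ hmin0.le hmin1
    · have h1 : (j : ℝ) = ∑ σ ∈ (Finset.range j).biUnion (wds N), mWeight p t σ := by
        rw [sum_biU]; simp [sum_mW p hpsum t htsum]
      rw [h1]
      refine Finset.sum_le_sum_of_subset_of_nonneg ?_ fun σ _ _ => (mW_pos p hp t ht σ).le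
      intro σ hσ
      rw [mem_biU] at hσ
      rw [hmem]
      exact (pow_le_pow_of_le_one hmin0.le hmin1 hσ.le).trans (le_aword t ht _ hmin0 hminle σ)
    · exact Finset.sum_nonneg fun σ _ => (pword_pos p hp σ).le
    · calc _ ≤ ∑ σ ∈ U, pword p σ :=
            Finset.sum_le_sum_of_subset_of_nonneg (Finset.filter_subset _ _)
              fun σ _ _ => (pword_pos p hp σ).le
        _ = ∑ k ∈ Finset.range L, (1 - p 0) ^ k := by
            rw [hU, sum_biU]; simp_rw [sum_pword p hpsum]
        _ ≤ 1 / p 0 := by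
            have hg := mul_neg_geom_sum (1 - p 0) L
            rw [sub_sub_cancel] at hg
            rw [le_div_iff₀ (hp 0), mul_comm, hg]
            have : 0 ≤ (1 - p 0) ^ L := pow_nonneg (by linarith) _
            linarith
  have hAs : ∑ i, t i * Real.log (s i) < 0 :=
    Finset.sum_neg (fun i _ => mul_neg_of_pos_of_neg (ht i)
      (Real.log_neg (hs i).1 (hs i).2)) Finset.univ_nonempty
  have hw1 := fun j I hI h0 => wald p hpsum t ht ht1 htsum t ht j I hI h0
  have hw2 := fun j I hI h0 => wald p hpsum t ht ht1 htsum s (fun i => (hs i).1) j I hI h0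
  generalize (∑ i, t i * Real.log (s i)) = As at *
  generalize (∑ i, t i * Real.log (t i)) = At at *
  generalize (∑ i, (p i.succ - (1 - p 0) * t i) * Real.log (s i)) = Ds at *
  generalize (∑ i, (p i.succ - (1 - p 0) * t i) * Real.log (t i)) = Dt at *
  have hq : 0 < 1 / p 0 := by have := hp 0; positivity
  generalize 1 / p 0 = q at *
  set E : ℝ := |Dt * As - Ds * At| with hE
  have hE0 : 0 ≤ E := abs_nonneg _
  obtain ⟨n, hn⟩ := exists_nat_ge (2 * (q * |Ds|) / -As)
  refine ⟨2 * (q * E) / As ^ 2 + 1, by positivity, n + 1, by omega, fun j hj => ?_⟩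
  obtain ⟨I, hI, h0, hM, hP0, hP⟩ := key j
  rw [hη j (by omega), hw1 j I hI h0, hw2 j I hI h0, hd₀]
  generalize ∑ ρ ∈ I, mWeight p t ρ = M at *
  generalize ∑ ρ ∈ I, pword p ρ = P at *
  have hj0 : (0 : ℝ) < j := by exact_mod_cast (by omega : 0 < j)
  have hjn : 2 * (q * |Ds|) ≤ j * -As := by
    rw [div_le_iff₀ (by linarith)] at hn
    refine hn.trans (mul_le_mul_of_nonneg_right ?_ (by linarith))
    exact_mod_cast (by omega : n ≤ j)
  have hPD : P * Ds ≤ q * |Ds| :=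
    (mul_le_mul_of_nonneg_left (le_abs_self _) hP0).trans
      (mul_le_mul_of_nonneg_right hP (abs_nonneg _))
  have hS : j * -As / 2 ≤ -(M * As + P * Ds) := by
    have : j * -As ≤ M * -As := mul_le_mul_of_nonneg_right hM (by linarith)
    linarith
  have hjA : 0 < j * -As := mul_pos hj0 (by linarith)
  set S := M * As + P * Ds with hSdef
  have hSn : S < 0 := by linarith
  have e : (M * At + P * Dt) / S - At / As = P * (Dt * As - Ds * At) / (S * As) := by
    rw [div_sub_div _ _ hSn.ne hAs.ne, hSdef]; ring
  have hSA : 0 < S * As := mul_pos_of_neg_of_neg hSn hAs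
  rw [e, abs_div, abs_mul, abs_of_nonneg hP0, abs_of_pos hSA, ← hE]
  have h1 : j * As ^ 2 / 2 ≤ S * As := by
    have := mul_le_mul_of_nonneg_right hS (by linarith : 0 ≤ -As)
    nlinarith
  have hA2 : 0 < As ^ 2 := by nlinarith
  calc P * E / (S * As) ≤ q * E / (j * As ^ 2 / 2) := by gcongr
    _ = 2 * (q * E) / As ^ 2 / j := by field_simp
    _ ≤ _ := by gcongr; linarith
end

section
/- There exists a constant C₇ > 0 such that for all j ≥ 1, |Σ_{σ∈Γ_j} p_σ log p_σ| ≤ C₇ and |Σ_{σ∈Γ_j} p_σ log s_σ| ≤ C₇. -/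
/-- `q̲ = min{ min_{1≤i≤N} p_i, min_{1≤i≤M} t_i }`. -/
noncomputable def qmin {N M : ℕ} (p : Fin (N + 1) → ℝ) (t : Fin M → ℝ) : ℝ :=
  min (⨅ i : Fin N, p i.succ) (⨅ i : Fin M, t i)

/-- The finite maximal antichain `Γ_j = {σ ∈ Ω^* : p_{σ⁻} ≥ q̲^j > p_σ}`. -/
def GammaJ {N M : ℕ} (p : Fin (N + 1) → ℝ) (t : Fin M → ℝ) (j : ℕ) : Set (List (Fin N)) :=
  {σ | σ ≠ [] ∧ qmin p t ^ j ≤ pword p σ.dropLast ∧ pword p σ < qmin p t ^ j}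

lemma aux_summable {N : ℕ} (w : Fin N → ℝ) (hw : ∀ i, 0 < w i) (hP : ∑ i, w i < 1) :
    Summable (fun l : List (Fin N) => (l.map w).prod * (l.length : ℝ)) := by
  have hnn : ∀ l : List (Fin N), 0 ≤ (l.map w).prod := by
    intro l
    apply List.prod_nonneg
    intro a ha
    obtain ⟨i, -, rfl⟩ := List.mem_map.1 ha
    exact (hw i).le
  rw [← (List.equivSigmaTuple (α := Fin N)).symm.summable_iff]
  have hterm : ∀ (n : ℕ) (v : Fin n → Fin N),
      ((List.ofFn v).map w).prod * ((List.ofFn v).length : ℝ) = (∏ k, w (v k)) * n := by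
    intro n v
    rw [List.map_ofFn, List.prod_ofFn, List.length_ofFn]
    rfl
  rw [summable_sigma_of_nonneg]
  · refine ⟨fun n => (hasSum_fintype _).summable, ?_⟩
    have h0 : 0 ≤ ∑ i, w i := Finset.sum_nonneg fun i _ => (hw i).le
    have h1 := summable_pow_mul_geometric_of_norm_lt_one (R := ℝ) 1 (r := ∑ i, w i)
      (by rw [Real.norm_eq_abs, abs_of_nonneg h0]; exact hP)
    refine h1.congr fun n => ?_
    rw [tsum_fintype]
    simp only [Function.comp, List.equivSigmaTuple, Equiv.coe_fn_symm_mk]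
    rw [Finset.sum_congr rfl (fun v _ => hterm n v), ← Finset.sum_mul, pow_one, mul_comm]
    congr 1
    have := Finset.prod_univ_sum (fun _ : Fin n => (Finset.univ : Finset (Fin N)))
      (fun _ i => w i)
    simpa using this
  · rintro ⟨n, v⟩
    exact mul_nonneg (hnn _) (by positivity)

lemma aux_log {N : ℕ} (a : Fin N → ℝ) (ha : ∀ i, 0 < a i) (l : List (Fin N)) :
    |Real.log (l.map a).prod| ≤ (∑ i, |Real.log (a i)|) * (l.length : ℝ) := by
  induction l with
  | nil => simp
  | cons x l ih =>
    have hpos : 0 < (l.map a).prod := by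
      apply List.prod_pos
      intro b hb
      obtain ⟨i, -, rfl⟩ := List.mem_map.1 hb
      exact ha i
    rw [List.map_cons, List.prod_cons, Real.log_mul (ha x).ne' hpos.ne']
    have h1 : |Real.log (a x)| ≤ ∑ i, |Real.log (a i)| :=
      Finset.single_le_sum (f := fun i => |Real.log (a i)|) (fun i _ => abs_nonneg _)
        (Finset.mem_univ x)
    have h2 := abs_add_le (Real.log (a x)) (Real.log (l.map a).prod)
    push_cast [List.length_cons]
    linarith

lemma aux_finsum {α : Type*} (S : Set α) (f g : α → ℝ) (hg : Summable g)
    (hfg : ∀ x, |f x| ≤ g x) : |∑ᶠ x ∈ S, f x| ≤ ∑' x, g x := by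
  have hg0 : ∀ x, 0 ≤ g x := fun x => (abs_nonneg _).trans (hfg x)
  have key : ∀ h : α → ℝ, (∀ x, |h x| ≤ g x) → |∑ᶠ x, h x| ≤ ∑' x, g x := by
    intro h hh
    by_cases hf : (Function.support h).Finite
    · rw [finsum_eq_sum _ hf]
      exact (Finset.abs_sum_le_sum_abs _ _).trans
        ((Finset.sum_le_sum fun x _ => hh x).trans (hg.sum_le_tsum _ fun x _ => hg0 x))
    · rw [finsum_of_infinite_support hf, abs_zero]
      exact tsum_nonneg hg0
  apply key
  intro x
  by_cases hx : x ∈ S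
  · simpa [hx] using hfg x
  · simpa [hx] using hg0 x

lemma aux_bound {N : ℕ} (w a : Fin N → ℝ) (hw : ∀ i, 0 < w i) (hP : ∑ i, w i < 1)
    (ha : ∀ i, 0 < a i) : ∃ C : ℝ, ∀ S : Set (List (Fin N)),
      |∑ᶠ σ ∈ S, (σ.map w).prod * Real.log (σ.map a).prod| ≤ C := by
  refine ⟨_, fun S => aux_finsum S _ _
    ((aux_summable w hw hP).mul_left (∑ i, |Real.log (a i)|)) fun l => ?_⟩
  have hnn : 0 ≤ (l.map w).prod := by
    apply List.prod_nonneg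
    intro b hb
    obtain ⟨i, -, rfl⟩ := List.mem_map.1 hb
    exact (hw i).le
  rw [abs_mul, abs_of_nonneg hnn]
  have := mul_le_mul_of_nonneg_left (aux_log a ha l) hnn
  linarith

theorem stmt18 (N M : ℕ) (hN : 2 ≤ N) (hM : 2 ≤ M)
    (p : Fin (N + 1) → ℝ) (hp : ∀ i, 0 < p i) (hpsum : ∑ i, p i = 1)
    (t : Fin M → ℝ) (ht : ∀ i, 0 < t i) (htsum : ∑ i, t i = 1)
    (s : Fin N → ℝ) (hs : ∀ i, s i ∈ Set.Ioo (0 : ℝ) 1) :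
    ∃ C₇ : ℝ, 0 < C₇ ∧ ∀ j : ℕ, 1 ≤ j →
      |∑ᶠ σ ∈ GammaJ p t j, pword p σ * Real.log (pword p σ)| ≤ C₇ ∧
      |∑ᶠ σ ∈ GammaJ p t j, pword p σ * Real.log (aword s σ)| ≤ C₇ := by
  have hP : ∑ i : Fin N, p i.succ < 1 := by
    rw [Fin.sum_univ_succ] at hpsum
    linarith [hp 0]
  obtain ⟨C1, h1⟩ := aux_bound (fun i : Fin N => p i.succ) (fun i : Fin N => p i.succ)
    (fun i => hp _) hP (fun i => hp _)
  obtain ⟨C2, h2⟩ := aux_bound (fun i : Fin N => p i.succ) s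
    (fun i => hp _) hP (fun i => (hs i).1)
  refine ⟨max (max C1 C2) 1, lt_max_of_lt_right one_pos, fun j _ => ⟨?_, ?_⟩⟩
  · exact (h1 (GammaJ p t j)).trans ((le_max_left _ _).trans (le_max_left _ _))
  · exact (h2 (GammaJ p t j)).trans ((le_max_right _ _).trans (le_max_left _ _))
end
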